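/- Let f : ℝ → ℝ be continuous and μ > 4 be such that 0 < μF(t) ≤ t f(t) for all t ≠ 0, where F(t) = ∫₀^t f(τ)dτ. Then there exist constants C₀, C₁ > 0 such that F(t) ≥ C₀ t^μ − C₁ t² for all t ≥ 0. -/

import Mathlib

open MeasureTheory

/-- A differential inequality `μ F(t) ≤ t F'(t)` on `(0, ∞)` makes `t ↦ F(t) t^(-μ)` monotone. -/
theorem monotoneOn_mul_rpow_neg {F f : ℝ → ℝ} {μ : ℝ}
    (hF : ∀ t, 0 < t → HasDerivAt F (f t) t) (h : ∀ t, 0 < t → μ * F t ≤ t * f t) :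
    MonotoneOn (fun t => F t * t ^ (-μ)) (Set.Ioi 0) := by
  have hd : ∀ t : ℝ, 0 < t → HasDerivAt (fun t => F t * t ^ (-μ))
      (f t * t ^ (-μ) + F t * (-μ * t ^ (-μ - 1))) t := fun t ht =>
    (hF t ht).mul (Real.hasDerivAt_rpow_const (Or.inl ht.ne'))
  refine monotoneOn_of_hasDerivWithinAt_nonneg (convex_Ioi 0)
    (fun t ht => (hd t ht).continuousAt.continuousWithinAt)
    (fun t ht => (hd t (interior_subset ht)).hasDerivWithinAt) fun t ht => ?_
  have ht0 : 0 < t := interior_subset ht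
  have hpow : t ^ (-μ) = t ^ (-μ - 1) * t := by
    rw [← Real.rpow_add_one ht0.ne', sub_add_cancel]
  have key : f t * t ^ (-μ) + F t * (-μ * t ^ (-μ - 1)) =
      t ^ (-μ - 1) * (t * f t - μ * F t) := by
    rw [hpow]; ring
  rw [key]
  exact mul_nonneg (Real.rpow_nonneg ht0.le _) (sub_nonneg.2 (h t ht0))

/-- Remark 1.1, second part: the Ambrosetti–Rabinowitz condition `(f₃)` implies
`F(t) ≥ C₀ t^μ − C₁ t²` for all `t ≥ 0`. -/
theorem statement8 (f : ℝ → ℝ) (μ : ℝ)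
    (hf : Continuous f) (hμ : 4 < μ)
    (hAR : ∀ t : ℝ, t ≠ 0 →
      0 < μ * ∫ τ in (0 : ℝ)..t, f τ ∧ μ * (∫ τ in (0 : ℝ)..t, f τ) ≤ t * f t) :
    ∃ C₀ > (0 : ℝ), ∃ C₁ > (0 : ℝ), ∀ t : ℝ, 0 ≤ t →
      C₀ * t ^ μ - C₁ * t ^ (2 : ℕ) ≤ ∫ τ in (0 : ℝ)..t, f τ := by
  have hμ0 : 0 < μ := by linarith
  have hpos : ∀ t : ℝ, t ≠ 0 → 0 < ∫ τ in (0 : ℝ)..t, f τ := fun t ht =>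
    pos_of_mul_pos_right (hAR t ht).1 hμ0.le
  have hmono : MonotoneOn (fun t : ℝ => (∫ τ in (0 : ℝ)..t, f τ) * t ^ (-μ)) (Set.Ioi 0) :=
    monotoneOn_mul_rpow_neg (fun t _ => hf.integral_hasStrictDerivAt 0 t |>.hasDerivAt)
      fun t ht => (hAR t ht.ne').2
  have hone := hpos 1 one_ne_zero
  refine ⟨_, hone, _, hone, fun t ht => ?_⟩
  rcases le_total 1 t with h1 | h1
  · have ht0 : 0 < t := by linarith
    have hle := hmono (Set.mem_Ioi.2 one_pos) (Set.mem_Ioi.2 ht0) h1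
    simp only [Real.one_rpow, mul_one, Real.rpow_neg ht, ← div_eq_mul_inv] at hle
    rw [le_div_iff₀ (Real.rpow_pos_of_pos ht0 μ)] at hle
    linarith [mul_nonneg hone.le (sq_nonneg t)]
  · rcases ht.eq_or_lt with rfl | ht0
    · simp [Real.zero_rpow hμ0.ne']
    · have hle : t ^ μ ≤ t ^ (2 : ℕ) := by
        rw [← Real.rpow_natCast t 2]
        exact Real.rpow_le_rpow_of_exponent_ge ht0 h1 (by push_cast; linarith)
      linarith [mul_le_mul_of_nonneg_left hle hone.le, hpos t ht0.ne']
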